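/- Let L > 0, let G ∈ [−L,L]^{n×n} be a fixed gain matrix, let η̂ : X → Δ_n be any class-probability estimation model, and let ĥ_G be the plug-in classifier induced by G on η̂. Then the supremum over randomized classifiers h of ⟨G, conf(h,D)⟩, minus ⟨G, conf(ĥ_G, D)⟩, is at most 2L·E_X[||η̂(X) − η(X)||_1]. -/

import Mathlib

open MeasureTheory Filter
open scoped ENNReal NNReal

noncomputable section

namespace Paper

variable {X : Type*} [MeasurableSpace X]

/-- `n × n` real matrices, as functions. -/
abbrev Mat (n : ℕ) := Fin n → Fin n → ℝ

/-- A randomized classifier: a measurable map into the probability simplex. -/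
def IsClassifier {n : ℕ} (h : X → Fin n → ℝ) : Prop :=
  Measurable h ∧ ∀ x, h x ∈ stdSimplex ℝ (Fin n)

/-- Confusion matrix: `conf(h,D)_{ij} = E[h_j(X) 1(Y = i)]`. -/
def conf {n : ℕ} (h : X → Fin n → ℝ) (D : Measure (X × Fin n)) : Mat n :=
  fun i j => ∫ z, (if z.2 = i then h z.1 j else 0) ∂D

/-- The set of feasible confusion matrices. -/
def feasibleConfs {n : ℕ} (D : Measure (X × Fin n)) : Set (Mat n) :=
  {C | ∃ h : X → Fin n → ℝ, IsClassifier h ∧ C = conf h D}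

/-- Entrywise inner product of matrices. -/
def minner {n : ℕ} (A B : Mat n) : ℝ := ∑ i, ∑ j, A i j * B i j

/-- Entrywise ℓ1 norm of a matrix. -/
def l1 {n : ℕ} (A : Mat n) : ℝ := ∑ i, ∑ j, |A i j|

/-- ℓ1 distance between vectors. -/
def l1dist {n : ℕ} (p q : Fin n → ℝ) : ℝ := ∑ i, |p i - q i|

/-- The matrix with a single `1` entry at `(i,j)`. -/
def single {n : ℕ} (i j : Fin n) : Mat n := fun k l => if k = i ∧ l = j then 1 else 0

/-- Gradient of `ψ` at `C`, as a matrix of partial derivatives. -/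
def grad {n : ℕ} (ψ : Mat n → ℝ) (C : Mat n) : Mat n :=
  fun i j => fderiv ℝ ψ C (single i j)

/-- The cube `[0,1]^{n×n}`. -/
def unitCube (n : ℕ) : Set (Mat n) := {C | ∀ i j, C i j ∈ Set.Icc (0:ℝ) 1}

/-- Marginal of `D` on the instance space. -/
def marginalX {n : ℕ} (D : Measure (X × Fin n)) : Measure X := D.map Prod.fst

/-- `η` is (a version of) the vector of conditional class probabilities under `D`. -/
def IsCondProb {n : ℕ} (D : Measure (X × Fin n)) (η : X → Fin n → ℝ) : Prop :=
  Measurable η ∧ (∀ x, η x ∈ stdSimplex ℝ (Fin n)) ∧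
  ∀ (i : Fin n) (A : Set X), MeasurableSet A →
    ∫ x in A, η x i ∂(marginalX D) = (D (A ×ˢ ({i} : Set (Fin n)))).toReal

/-- The law `ν` of `η(X)`. -/
def etaLaw {n : ℕ} (D : Measure (X × Fin n)) (η : X → Fin n → ℝ) : Measure (Fin n → ℝ) :=
  (marginalX D).map η

/-- The uniform (normalized Hausdorff) base measure on the probability simplex. -/
def uniformSimplex (n : ℕ) : Measure (Fin n → ℝ) :=
  (μH[(n : ℝ) - 1]).restrict (stdSimplex ℝ (Fin n))

/-- Assumption A: the law of `η(X)` is absolutely continuous w.r.t. the uniform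
measure on the simplex. -/
def AssumptionA {n : ℕ} (D : Measure (X × Fin n)) (η : X → Fin n → ℝ) : Prop :=
  etaLaw D η ≪ uniformSimplex n

/-- Assumption B: `ψ` is continuous, differentiable and bounded over the feasible
confusion matrices, strictly increasing in diagonal entries, non-increasing in
off-diagonal entries. -/
def AssumptionB {n : ℕ} (ψ : Mat n → ℝ) (D : Measure (X × Fin n)) : Prop :=
  ContinuousOn ψ (feasibleConfs D) ∧
  (∀ C ∈ feasibleConfs D, DifferentiableAt ℝ ψ C) ∧
  (∃ B : ℝ, ∀ C ∈ feasibleConfs D, |ψ C| ≤ B) ∧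
  (∀ C ∈ unitCube n, ∀ (i : Fin n), ∀ t : ℝ, 0 < t →
      C + t • single i i ∈ unitCube n → ψ C < ψ (C + t • single i i)) ∧
  (∀ C ∈ unitCube n, ∀ (i j : Fin n), i ≠ j → ∀ t : ℝ, 0 < t →
      C + t • single i j ∈ unitCube n → ψ (C + t • single i j) ≤ ψ C)

/-- Largest index among the maximizers of `s` (ties broken towards larger indices). -/
def argmaxIdx {n : ℕ} [NeZero n] (s : Fin n → ℝ) : Fin n := by
  classical
  exact (Finset.univ.filter fun y => ∀ y', s y' ≤ s y).max' (by
    haveI : Nonempty (Fin n) := ⟨⟨0, Nat.pos_of_ne_zero (NeZero.ne n)⟩⟩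
    obtain ⟨b, hb⟩ := Finite.exists_max s
    exact ⟨b, Finset.mem_filter.mpr ⟨Finset.mem_univ _, hb⟩⟩)

/-- The scores `y ↦ g_y^T p` of the columns of a gain matrix. -/
def colScore {n : ℕ} (G : Mat n) (p : Fin n → ℝ) : Fin n → ℝ := fun y => ∑ k, G k y * p k

/-- The scores `y ↦ (G p)_y` of the rows of a gain matrix. -/
def rowScore {n : ℕ} (G : Mat n) (p : Fin n → ℝ) : Fin n → ℝ := fun y => ∑ k, G y k * p k

/-- The plug-in (deterministic) classifier induced by gain matrix `G` on a
class-probability model `ηh`. -/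
def plugIn {n : ℕ} [NeZero n] (G : Mat n) (ηh : X → Fin n → ℝ) : X → Fin n → ℝ :=
  fun x i => if i = argmaxIdx (colScore G (ηh x)) then 1 else 0

/-- The deterministic classifier `x ↦ argmax_y [G μ(x)]_y` (largest index tie-break). -/
def plugInRow {n : ℕ} [NeZero n] (G : Mat n) (f : X → Fin n → ℝ) : X → Fin n → ℝ :=
  fun x i => if i = argmaxIdx (rowScore G (f x)) then 1 else 0

/-- Empirical measure of a finite sample. -/
def empMeasure {Z : Type*} [MeasurableSpace Z] {m : ℕ} (S : Fin m → Z) : Measure Z :=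
  (m : ℝ≥0∞)⁻¹ • ∑ i : Fin m, Measure.dirac (S i)

/-- The distribution of an i.i.d. sample of size `m` from `D`. -/
def iidSample {Z : Type*} [MeasurableSpace Z] (D : Measure Z) (m : ℕ) :
    Measure (Fin m → Z) :=
  Measure.pi fun _ => D

lemma floor_split_le (a : ℝ) (ha : 0 ≤ a) (m : ℕ) : ⌊(1 - a) * (m : ℝ)⌋₊ ≤ m := by
  calc ⌊(1 - a) * (m : ℝ)⌋₊ ≤ ⌊(m : ℝ)⌋₊ := by
        apply Nat.floor_le_floor
        nlinarith [mul_nonneg ha (Nat.cast_nonneg (α := ℝ) m)]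
    _ = m := Nat.floor_natCast m

/-- First part of the sample (size `m₁`). -/
def firstPart {Z : Type*} {m : ℕ} (m₁ : ℕ) (h : m₁ ≤ m) (S : Fin m → Z) : Fin m₁ → Z :=
  fun i => S (Fin.castLE h i)

/-- Last part of the sample (size `m - m₁`). -/
def lastPart {Z : Type*} {m : ℕ} (m₁ : ℕ) (h : m₁ ≤ m) (S : Fin m → Z) :
    Fin (m - m₁) → Z :=
  fun i => S ⟨m₁ + i.1, by have := i.2; omega⟩

/-- The first `⌊(1-a) m⌋` examples of the sample (training part `S'`). -/
def splitFirst {Z : Type*} (a : ℝ) (ha : 0 ≤ a) {m : ℕ} (S : Fin m → Z) :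
    Fin ⌊(1 - a) * (m : ℝ)⌋₊ → Z :=
  firstPart _ (floor_split_le a ha m) S

/-- The remaining `m - ⌊(1-a) m⌋ = ⌈a m⌉` examples of the sample (validation part `S''`). -/
def splitLast {Z : Type*} (a : ℝ) (ha : 0 ≤ a) {m : ℕ} (S : Fin m → Z) :
    Fin (m - ⌊(1 - a) * (m : ℝ)⌋₊) → Z :=
  lastPart _ (floor_split_le a ha m) S

/-- Expected ℓ1 estimation error of a class-probability model. -/
def cpeErr {n : ℕ} (D : Measure (X × Fin n)) (η ηh : X → Fin n → ℝ) : ℝ :=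
  ∫ x, l1dist (ηh x) (η x) ∂(marginalX D)

/-- Optimal value `P*_D` of the performance metric over randomized classifiers. -/
def Pstar {n : ℕ} (ψ : Mat n → ℝ) (D : Measure (X × Fin n)) : ℝ :=
  sSup {r | ∃ h : X → Fin n → ℝ, IsClassifier h ∧ r = ψ (conf h D)}

/-- `L`-Lipschitz with respect to the entrywise ℓ1 norm on a set of matrices. -/
def LipschitzL1On {n : ℕ} (L : ℝ) (ψ : Mat n → ℝ) (s : Set (Mat n)) : Prop :=
  ∀ C₁ ∈ s, ∀ C₂ ∈ s, |ψ C₁ - ψ C₂| ≤ L * l1 (C₁ - C₂)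

/-- `β`-smooth with respect to the ℓ1 norm on a set of matrices: gradients are
`β`-Lipschitz from ℓ1 to ℓ∞. -/
def SmoothL1On {n : ℕ} (β : ℝ) (ψ : Mat n → ℝ) (s : Set (Mat n)) : Prop :=
  ∀ C₁ ∈ s, ∀ C₂ ∈ s, ∀ i j, |grad ψ C₁ i j - grad ψ C₂ i j| ≤ β * l1 (C₁ - C₂)

/-- Largest value of a vector. -/
def top1 {n : ℕ} (v : Fin n → ℝ) : ℝ := sSup (Set.range v)

/-- Second-largest value (with multiplicity) of a vector. -/
def top2 {n : ℕ} (v : Fin n → ℝ) : ℝ :=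
  sSup {r | ∃ y y', y ≠ y' ∧ r = min (v y) (v y')}

/-- One step of the BayesCG (sample-based conditional gradient) recursion:
`hs` is a run of the algorithm applied to `ψ` with `T` iterations, sample `S`
and split parameter `a`. -/
def BayesCGRun {n : ℕ} [NeZero n] (a : ℝ) (ha : 0 ≤ a) (ψ : Mat n → ℝ)
    (cpe : ∀ k : ℕ, (Fin k → X × Fin n) → X → Fin n → ℝ)
    (m T : ℕ) (S : Fin m → X × Fin n) (hs : ℕ → X → Fin n → ℝ) : Prop :=
  IsClassifier (hs 0) ∧
  ∀ j : ℕ, 1 ≤ j → j ≤ T →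
    hs j = fun x i =>
      (1 - 2 / ((j : ℝ) + 1)) * hs (j - 1) x i +
        (2 / ((j : ℝ) + 1)) *
          plugIn (grad ψ (conf (hs (j - 1)) (empMeasure (splitLast a ha S))))
            (cpe _ (splitFirst a ha S)) x i


/-! ## Statement 7 -/


lemma argmaxIdx_eq_iff {n : ℕ} [NeZero n] (s : Fin n → ℝ) (y : Fin n) :
    argmaxIdx s = y ↔ (∀ y', s y' ≤ s y) ∧ ∀ z, (∀ y', s y' ≤ s z) → z ≤ y := by
  classical
  unfold argmaxIdx
  rw [Finset.max'_eq_iff]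
  simp

lemma le_argmaxIdx {n : ℕ} [NeZero n] (s : Fin n → ℝ) (y : Fin n) : s y ≤ s (argmaxIdx s) :=
  ((argmaxIdx_eq_iff s _).1 rfl).1 y

lemma measurable_argmaxIdx {n : ℕ} [NeZero n] :
    Measurable (argmaxIdx : (Fin n → ℝ) → Fin n) := by
  refine measurable_to_countable' fun y => ?_
  have hset : (argmaxIdx : (Fin n → ℝ) → Fin n) ⁻¹' {y} =
      {s | (∀ y', s y' ≤ s y) ∧ ∀ z, (∀ y', s y' ≤ s z) → z ≤ y} := by
    ext s
    exact argmaxIdx_eq_iff s y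
  rw [hset]
  have hmax (z : Fin n) : MeasurableSet {s : Fin n → ℝ | ∀ y', s y' ≤ s z} := by
    rw [Set.ofPred_forall]
    exact MeasurableSet.iInter fun y' =>
      measurableSet_le (measurable_pi_apply y') (measurable_pi_apply z)
  refine (hmax y).inter ?_
  change MeasurableSet {s : Fin n → ℝ | ∀ z, (∀ y', s y' ≤ s z) → z ≤ y}
  rw [Set.ofPred_forall]
  exact MeasurableSet.iInter fun z => (hmax z).imp (MeasurableSet.const _)

lemma measurable_colScore {n : ℕ} (G : Mat n) : Measurable (colScore G) := by
  unfold colScore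
  fun_prop

lemma isClassifier_plugIn {n : ℕ} [NeZero n] (G : Mat n)
    {ηh : X → Fin n → ℝ} (hηh : Measurable ηh) : IsClassifier (plugIn G ηh) := by
  refine ⟨measurable_pi_lambda _ fun i => ?_, fun x => ⟨fun i => ?_, ?_⟩⟩
  · refine Measurable.ite ?_ measurable_const measurable_const
    have hm := measurable_argmaxIdx.comp ((measurable_colScore G).comp hηh)
    exact measurableSet_eq_fun measurable_const hm
  · unfold plugIn
    split_ifs <;> norm_num
  · simp [plugIn]

lemma sum_plugIn_mul {X : Type*} {n : ℕ} [NeZero n] (G : Mat n)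
    (ηh : X → Fin n → ℝ) (x : X) (v : Fin n → ℝ) :
    ∑ j, plugIn G ηh x j * v j = v (argmaxIdx (colScore G (ηh x))) := by
  simp [plugIn]

lemma abs_le_one_of_mem_stdSimplex {n : ℕ} {p : Fin n → ℝ} (hp : p ∈ stdSimplex ℝ (Fin n))
    (i : Fin n) : |p i| ≤ 1 := by
  rw [abs_of_nonneg (hp.1 i), ← hp.2]
  exact Finset.single_le_sum (fun j _ => hp.1 j) (Finset.mem_univ i)

instance isProbabilityMeasure_marginalX {n : ℕ}
    (D : Measure (X × Fin n)) [IsProbabilityMeasure D] : IsProbabilityMeasure (marginalX D) :=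
  Measure.isProbabilityMeasure_map measurable_fst.aemeasurable

lemma integrable_of_mem_stdSimplex {μ : Measure X}
    [IsFiniteMeasure μ] {n : ℕ} {p : X → Fin n → ℝ} (hp : Measurable p)
    (hps : ∀ x, p x ∈ stdSimplex ℝ (Fin n)) (i : Fin n) : Integrable (fun x => p x i) μ :=
  .of_bound (by fun_prop) 1 <| ae_of_all _ fun x => abs_le_one_of_mem_stdSimplex (hps x) i

lemma integrable_mul_of_mem_stdSimplex {μ : Measure X}
    [IsFiniteMeasure μ] {n : ℕ} {p q : X → Fin n → ℝ} (hp : Measurable p)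
    (hps : ∀ x, p x ∈ stdSimplex ℝ (Fin n)) (hq : Measurable q)
    (hqs : ∀ x, q x ∈ stdSimplex ℝ (Fin n)) (i j : Fin n) :
    Integrable (fun x => p x i * q x j) μ :=
  (integrable_of_mem_stdSimplex hq hqs j).bdd_mul (c := 1) (by fun_prop) <|
    ae_of_all _ fun x => abs_le_one_of_mem_stdSimplex (hps x) i

lemma IsCondProb.map_restrict_eq_withDensity {n : ℕ}
    {D : Measure (X × Fin n)} [IsProbabilityMeasure D] {η : X → Fin n → ℝ}
    (hη : IsCondProb D η) (i : Fin n) :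
    (D.restrict (Prod.snd ⁻¹' {i})).map Prod.fst =
      (marginalX D).withDensity fun x => ENNReal.ofReal (η x i) := by
  obtain ⟨hm, hs, hcond⟩ := hη
  ext A hA
  rw [Measure.map_apply measurable_fst hA, Measure.restrict_apply (measurable_fst hA),
    withDensity_apply _ hA, ← ofReal_integral_eq_lintegral_ofReal
      (integrable_of_mem_stdSimplex hm hs i).integrableOn (ae_of_all _ fun x => (hs x).1 i),
    hcond i A hA, ENNReal.ofReal_toReal (measure_ne_top D _)]
  rfl

lemma IsCondProb.conf_eq {n : ℕ} {D : Measure (X × Fin n)}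
    [IsProbabilityMeasure D] {η : X → Fin n → ℝ} (hη : IsCondProb D η) {h : X → Fin n → ℝ}
    (hh : Measurable h) (i j : Fin n) :
    conf h D i j = ∫ x, η x i * h x j ∂marginalX D := by
  have hmi : Measurable fun x => η x i := (measurable_pi_apply i).comp hη.1
  have hmj : Measurable fun x => h x j := (measurable_pi_apply j).comp hh
  calc conf h D i j = ∫ z, (Prod.snd ⁻¹' {i}).indicator (fun z => h z.1 j) z ∂D := by
        classical
        exact integral_congr_ae (ae_of_all _ fun z => by simp [Set.indicator_apply])
    _ = ∫ z in Prod.snd ⁻¹' {i}, h z.1 j ∂D :=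
      integral_indicator (measurable_snd (measurableSet_singleton i))
    _ = ∫ x, h x j ∂(D.restrict (Prod.snd ⁻¹' {i})).map Prod.fst :=
      (integral_map measurable_fst.aemeasurable hmj.aestronglyMeasurable).symm
    _ = ∫ x, (ENNReal.ofReal (η x i)).toReal • h x j ∂marginalX D := by
      rw [hη.map_restrict_eq_withDensity, integral_withDensity_eq_integral_toReal_smul
        hmi.ennreal_ofReal (ae_of_all _ fun x => ENNReal.ofReal_lt_top)]
    _ = ∫ x, η x i * h x j ∂marginalX D := by
      simp only [ENNReal.toReal_ofReal ((hη.2.1 _).1 i), smul_eq_mul]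

lemma sum_mul_colScore {n : ℕ} (G : Mat n) (p w : Fin n → ℝ) :
    ∑ j, w j * colScore G p j = ∑ i, ∑ j, G i j * (p i * w j) := by
  rw [Finset.sum_comm]
  refine Finset.sum_congr rfl fun j _ => ?_
  rw [colScore, Finset.mul_sum]
  exact Finset.sum_congr rfl fun i _ => by ring

lemma integrable_sum_mul_colScore {μ : Measure X}
    [IsFiniteMeasure μ] {n : ℕ} (G : Mat n) {η : X → Fin n → ℝ} (hη : Measurable η)
    (hηs : ∀ x, η x ∈ stdSimplex ℝ (Fin n)) {h : X → Fin n → ℝ} (hh : IsClassifier h) :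
    Integrable (fun x => ∑ j, h x j * colScore G (η x) j) μ := by
  simp only [sum_mul_colScore]
  exact integrable_finsetSum _ fun i _ => integrable_finsetSum _ fun j _ =>
    (integrable_mul_of_mem_stdSimplex hη hηs hh.1 hh.2 i j).const_mul _

/-- The linear performance of a classifier is its expected score under the true class
probabilities. -/
lemma IsCondProb.minner_conf {n : ℕ} {D : Measure (X × Fin n)}
    [IsProbabilityMeasure D] {η : X → Fin n → ℝ} (hη : IsCondProb D η) (G : Mat n)
    {h : X → Fin n → ℝ} (hh : IsClassifier h) :
    minner G (conf h D) = ∫ x, ∑ j, h x j * colScore G (η x) j ∂marginalX D := by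
  have hint (i j : Fin n) : Integrable (fun x => G i j * (η x i * h x j)) (marginalX D) :=
    (integrable_mul_of_mem_stdSimplex hη.1 hη.2.1 hh.1 hh.2 i j).const_mul _
  simp only [sum_mul_colScore]
  rw [integral_finsetSum _ fun i _ => integrable_finsetSum _ fun j _ => hint i j]
  refine Finset.sum_congr rfl fun i _ => ?_
  rw [integral_finsetSum _ fun j _ => hint i j]
  refine Finset.sum_congr rfl fun j _ => ?_
  rw [integral_const_mul, hη.conf_eq hh.1]

lemma abs_colScore_sub_le {n : ℕ} {G : Mat n} {L : ℝ} (hG : ∀ i j, |G i j| ≤ L)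
    (p q : Fin n → ℝ) (y : Fin n) :
    |colScore G p y - colScore G q y| ≤ L * l1dist p q := by
  simp only [colScore, l1dist, ← Finset.sum_sub_distrib, ← mul_sub, Finset.mul_sum]
  refine (Finset.abs_sum_le_sum_abs _ _).trans (Finset.sum_le_sum fun k _ => ?_)
  rw [abs_mul]
  exact mul_le_mul_of_nonneg_right (hG k y) (abs_nonneg _)

lemma sum_mul_le_of_mem_stdSimplex {n : ℕ} {w : Fin n → ℝ} (hw : w ∈ stdSimplex ℝ (Fin n))
    {v : Fin n → ℝ} {c : ℝ} (hv : ∀ j, v j ≤ c) : ∑ j, w j * v j ≤ c := by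
  calc ∑ j, w j * v j ≤ ∑ j, w j * c :=
        Finset.sum_le_sum fun j _ => mul_le_mul_of_nonneg_left (hv j) (hw.1 j)
    _ = c := by rw [← Finset.sum_mul, hw.2, one_mul]

/-- Pointwise regret bound for maximizing the scores of an estimate `q` instead of `p`. -/
lemma sum_mul_colScore_le {n : ℕ} [NeZero n] {G : Mat n} {L : ℝ} (hG : ∀ i j, |G i j| ≤ L)
    (p q : Fin n → ℝ) {w : Fin n → ℝ} (hw : w ∈ stdSimplex ℝ (Fin n)) :
    ∑ j, w j * colScore G p j ≤
      colScore G p (argmaxIdx (colScore G q)) + 2 * L * l1dist q p := by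
  refine sum_mul_le_of_mem_stdSimplex hw fun j => ?_
  have h₁ := (abs_le.1 (abs_colScore_sub_le hG q p j)).1
  have h₂ := (abs_le.1 (abs_colScore_sub_le hG q p (argmaxIdx (colScore G q)))).2
  have h₃ := le_argmaxIdx (colScore G q) j
  linarith

theorem stmt7 {X : Type*} [MeasurableSpace X] {n : ℕ} [NeZero n] (hn : 2 ≤ n)
    (D : Measure (X × Fin n)) [IsProbabilityMeasure D]
    (η : X → Fin n → ℝ) (hη : IsCondProb D η)
    (L : ℝ) (hL : 0 < L) (G : Mat n) (hG : ∀ i j, G i j ∈ Set.Icc (-L) L)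
    (ηh : X → Fin n → ℝ) (hηh : Measurable ηh)
    (hηhs : ∀ x, ηh x ∈ stdSimplex ℝ (Fin n)) :
    ∀ h : X → Fin n → ℝ, IsClassifier h →
      minner G (conf h D) - minner G (conf (plugIn G ηh) D)
        ≤ 2 * L * cpeErr D η ηh := by
  intro h hh
  have hp := isClassifier_plugIn G hηh
  have hl : Integrable (fun x => l1dist (ηh x) (η x)) (marginalX D) :=
    integrable_finsetSum _ fun i _ => ((integrable_of_mem_stdSimplex hηh hηhs i).sub
      (integrable_of_mem_stdSimplex hη.1 hη.2.1 i)).abs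
  rw [hη.minner_conf G hh, hη.minner_conf G hp, cpeErr, sub_le_iff_le_add', ← integral_const_mul,
    ← integral_add (integrable_sum_mul_colScore G hη.1 hη.2.1 hp) (hl.const_mul _)]
  refine integral_mono (integrable_sum_mul_colScore G hη.1 hη.2.1 hh)
    ((integrable_sum_mul_colScore G hη.1 hη.2.1 hp).add (hl.const_mul _)) fun x => ?_
  dsimp only
  rw [sum_plugIn_mul]
  exact sum_mul_colScore_le (fun i j => abs_le.2 (hG i j)) (η x) (ηh x) (hh.2 x)

end Paper
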